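/- arXiv:1011.3009 — 2 statements merged into one kernel-verified Lean document; each statement's English description precedes it below -/
import Mathlib

section
/- Every K-algebra endomorphism of the algebra I_1 of polynomial integro-differential operators is bijective, i.e., is a K-algebra automorphism of I_1. -/
set_option linter.unusedSectionVars false

open Polynomial

noncomputable section

variable (K : Type*) [Field K] [CharZero K]

/-- Formal differentiation `∂` as a `K`-linear endomorphism of `K[x]`. -/
def derOp : Module.End K (Polynomial K) := Polynomial.derivative

/-- Multiplication by `x` as a `K`-linear endomorphism of `K[x]`. -/
def xOp : Module.End K (Polynomial K) := LinearMap.mulLeft K (Polynomial.X : Polynomial K)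

/-- Integration `∫`: the unique `K`-linear map with `∫ xⁿ = xⁿ⁺¹/(n+1)`. -/
def intOp : Module.End K (Polynomial K) :=
  Polynomial.lsum fun n => ((n : K) + 1)⁻¹ • Polynomial.monomial (n + 1)

/-- The algebra `I₁` of polynomial integro-differential operators: the unital
`K`-subalgebra of `End_K K[x]` generated by `X`, `∂` and `∫`. -/
def I1 : Subalgebra K (Module.End K (Polynomial K)) :=
  Algebra.adjoin K {xOp K, derOp K, intOp K}

/-- `H := ∂ ∘ X`. -/
def Hop : Module.End K (Polynomial K) := derOp K * xOp K

/-- `e_{ij} := ∫^i ∂^j - ∫^{i+1} ∂^{j+1}`. -/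
def eOp (i j : ℕ) : Module.End K (Polynomial K) :=
  intOp K ^ i * derOp K ^ j - intOp K ^ (i + 1) * derOp K ^ (j + 1)

/-- `F`, the `K`-linear span of the `e_{ij}`. -/
def Fspan : Submodule K (Module.End K (Polynomial K)) :=
  Submodule.span K (Set.range fun p : ℕ × ℕ => eOp K p.1 p.2)

lemma xOp_mem : xOp K ∈ I1 K := Algebra.subset_adjoin (by simp)
lemma derOp_mem : derOp K ∈ I1 K := Algebra.subset_adjoin (by simp)
lemma intOp_mem : intOp K ∈ I1 K := Algebra.subset_adjoin (by simp)
lemma Hop_mem : Hop K ∈ I1 K := mul_mem (derOp_mem K) (xOp_mem K)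
lemma eOp_mem (i j : ℕ) : eOp K i j ∈ I1 K :=
  sub_mem (mul_mem (pow_mem (intOp_mem K) i) (pow_mem (derOp_mem K) j))
    (mul_mem (pow_mem (intOp_mem K) (i + 1)) (pow_mem (derOp_mem K) (j + 1)))

/-- `H` as an element of `I₁`. -/
def HelI : I1 K := ⟨Hop K, Hop_mem K⟩
/-- `∂` as an element of `I₁`. -/
def DelI : I1 K := ⟨derOp K, derOp_mem K⟩
/-- `∫` as an element of `I₁`. -/
def IntI : I1 K := ⟨intOp K, intOp_mem K⟩


section aux
variable {K}

/-- The basis `x^i / i!`. -/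
def bas : Module.Basis ℕ K (Polynomial K) :=
  (Polynomial.basisMonomials K).isUnitSMul (w := fun i => ((i.factorial : K))⁻¹)
    (fun i => (IsUnit.mk0 _ (inv_ne_zero (Nat.cast_ne_zero.2 i.factorial_ne_zero))))

lemma bas_apply (i : ℕ) : (bas i : K[X]) = monomial i ((i.factorial : K))⁻¹ := by
  simp [bas, Module.Basis.isUnitSMul_apply, smul_monomial]

lemma factK (i : ℕ) : (i.factorial : K) ≠ 0 := Nat.cast_ne_zero.2 i.factorial_ne_zero

lemma succK (i : ℕ) : (i : K) + 1 ≠ 0 := Nat.cast_add_one_ne_zero i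

lemma der_bas_zero : derOp K (bas 0) = 0 := by
  simp [bas_apply, derOp]

lemma der_bas_succ (i : ℕ) : derOp K (bas (i+1)) = bas i := by
  have h1 := factK (K := K) i
  have h2 := succK (K := K) i
  simp only [bas_apply, derOp, derivative_monomial, Nat.factorial_succ]
  congr 1
  push_cast
  field_simp

lemma int_bas (i : ℕ) : intOp K (bas i) = bas (i+1) := by
  have h1 := factK (K := K) i
  have h2 := succK (K := K) i
  simp only [bas_apply, intOp, Nat.factorial_succ]
  rw [Polynomial.lsum_apply, Polynomial.sum_monomial_index]
  · simp only [LinearMap.smul_apply, smul_monomial]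
    congr 1
    push_cast
    simp [mul_comm]
  · simp

lemma x_bas (i : ℕ) : xOp K (bas i) = ((i : K)+1) • bas (i+1) := by
  have h1 := factK (K := K) i
  have h2 := succK (K := K) i
  simp only [bas_apply, xOp, LinearMap.mulLeft_apply, X_mul_monomial, smul_monomial, Nat.factorial_succ]
  congr 1
  push_cast
  rw [smul_eq_mul]
  field_simp

lemma H_bas (i : ℕ) : Hop K (bas i) = ((i : K)+1) • bas i := by
  simp [Hop, x_bas, der_bas_succ]

lemma der_int : derOp K * intOp K = 1 := by
  apply bas.ext; intro i; simp [int_bas, der_bas_succ]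

lemma H_der : derOp K * Hop K = Hop K * derOp K + derOp K := by
  apply bas.ext; intro i
  cases i with
  | zero => simp [H_bas, der_bas_zero]
  | succ i => simp [H_bas, der_bas_succ]; module

lemma H_int : Hop K * intOp K = intOp K * Hop K + intOp K := by
  apply bas.ext; intro i
  simp [H_bas, int_bas]; module

lemma H_e : Hop K * (1 - intOp K * derOp K) = 1 - intOp K * derOp K := by
  apply bas.ext; intro i
  cases i with
  | zero => simp [H_bas, der_bas_zero]
  | succ i => simp [der_bas_succ, int_bas]

lemma x_eq : xOp K = intOp K * Hop K := by
  apply bas.ext; intro i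
  simp [H_bas, int_bas, x_bas]

/-- coordinates -/
def co (j : ℕ) : K[X] →ₗ[K] K := bas.coord j

lemma co_bas (i j : ℕ) : co j (bas i : K[X]) = if i = j then 1 else 0 := by
  simp [co, Finsupp.single_apply]

lemma co_ext {v w : K[X]} (h : ∀ j, co j v = co j w) : v = w := bas.ext_elem h

lemma co_der (j : ℕ) (v : K[X]) : co j (derOp K v) = co (j+1) v := by
  have : co j ∘ₗ derOp K = co (j+1) := by
    apply bas.ext; intro i
    cases i with
    | zero => simp [der_bas_zero, co_bas]
    | succ i => simp [der_bas_succ, co_bas]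
  exact LinearMap.congr_fun this v

lemma co_int_zero (v : K[X]) : co 0 (intOp K v) = 0 := by
  have : co 0 ∘ₗ intOp K = 0 := by
    apply bas.ext; intro i
    simp [int_bas, co_bas]
  exact LinearMap.congr_fun this v

lemma co_int_succ (j : ℕ) (v : K[X]) : co (j+1) (intOp K v) = co j v := by
  have : co (j+1) ∘ₗ intOp K = co j := by
    apply bas.ext; intro i
    simp [int_bas, co_bas]
  exact LinearMap.congr_fun this v

lemma co_H (j : ℕ) (v : K[X]) : co j (Hop K v) = ((j:K)+1) * co j v := by
  have : co j ∘ₗ Hop K = ((j:K)+1) • co j := by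
    apply bas.ext; intro i
    simp only [LinearMap.comp_apply, H_bas, LinearMap.smul_apply, map_smul, co_bas]
    split_ifs with h <;> simp [h]
  exact LinearMap.congr_fun this v

/-- polys of degree `< L` -/
lemma mem_P {L : ℕ} {v : K[X]} : v ∈ degreeLT K L ↔ ∀ j, L ≤ j → co j v = 0 := by
  have hc : ∀ j, co j v = 0 ↔ v.coeff j = 0 := by
    intro j
    have : co j = (j.factorial : K) • lcoeff K j := by
      apply bas.ext; intro i
      rw [co_bas]
      simp only [bas_apply, LinearMap.smul_apply, lcoeff_apply, coeff_monomial]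
      split_ifs with h
      · subst h; rw [smul_eq_mul, mul_inv_cancel₀ (factK i)]
      · simp
    rw [this]; simp [Nat.factorial_ne_zero]
  simp only [hc]
  rw [mem_degreeLT, degree_lt_iff_coeff_zero]

lemma exists_P (v : K[X]) : ∃ L, v ∈ degreeLT K L :=
  ⟨v.natDegree + 1, by rw [mem_degreeLT]; exact_mod_cast degree_lt_iff_coeff_zero _ _ |>.2 (fun m hm => coeff_eq_zero_of_natDegree_lt (by omega))⟩

lemma P_mono {L M : ℕ} (h : L ≤ M) {v : K[X]} (hv : v ∈ degreeLT K L) : v ∈ degreeLT K M :=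
  degreeLT_mono h hv

lemma bas_mem_P {i L : ℕ} (h : i < L) : (bas i : K[X]) ∈ degreeLT K L := by
  rw [mem_P]; intro j hj; rw [co_bas, if_neg (by omega)]

lemma P_sum {L : ℕ} {v : K[X]} (hv : v ∈ degreeLT K L) :
    v = ∑ j ∈ Finset.range L, co j v • bas j := by
  apply co_ext; intro j
  rw [mem_P] at hv
  simp only [map_sum, map_smul, co_bas, smul_eq_mul, mul_ite, mul_one, mul_zero]
  rw [Finset.sum_ite_eq' (Finset.range L) j]
  split_ifs with h
  · rfl
  · exact hv j (by simpa using h)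

/-- symbol -/
def HasSym (a : Module.End K K[X]) (s : ℤ → K[X]) : Prop :=
  ∃ d M : ℕ, (∀ k : ℤ, (d : ℤ) < |k| → s k = 0) ∧
    ∀ i, M ≤ i → ∀ j : ℕ, co j (a (bas i)) = (s ((j:ℤ) - i)).eval (i : K)

lemma HasSym.add {a b : Module.End K K[X]} {s t : ℤ → K[X]} (ha : HasSym a s) (hb : HasSym b t) :
    HasSym (a + b) (s + t) := by
  obtain ⟨d, M, h1, h2⟩ := ha
  obtain ⟨d', M', h1', h2'⟩ := hb
  refine ⟨max d d', max M M', fun k hk => ?_, fun i hi j => ?_⟩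
  · push_cast at hk
    simp [h1 k (lt_of_le_of_lt (le_max_left _ _) hk), h1' k (lt_of_le_of_lt (le_max_right _ _) hk)]
  · simp [h2 i (le_of_max_le_left hi), h2' i (le_of_max_le_right hi)]

lemma HasSym.smul {a : Module.End K K[X]} {s : ℤ → K[X]} (c : K) (ha : HasSym a s) :
    HasSym (c • a) (c • s) := by
  obtain ⟨d, M, h1, h2⟩ := ha
  refine ⟨d, M, fun k hk => ?_, fun i hi j => ?_⟩
  · simp [h1 k hk]
  · simp [h2 i hi]

lemma HasSym.one : HasSym (1 : Module.End K K[X]) (Pi.single 0 1) := by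
  refine ⟨0, 0, fun k hk => ?_, fun i hi j => ?_⟩
  · have : k ≠ 0 := by rintro rfl; simp at hk
    simp [this]
  · simp only [Module.End.one_apply, co_bas, Pi.single_apply]
    by_cases h : i = j
    · simp [h]
    · have : (j:ℤ) - i ≠ 0 := by omega
      simp [h, this]

lemma HasSym.der {a : Module.End K K[X]} {s : ℤ → K[X]} (ha : HasSym a s) :
    HasSym (derOp K * a) (fun k => s (k+1)) := by
  obtain ⟨d, M, h1, h2⟩ := ha
  refine ⟨d+1, M, fun k hk => h1 _ ?_, fun i hi j => ?_⟩
  · push_cast at hk; grind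
  · rw [Module.End.mul_apply, co_der, h2 i hi]
    congr 2; push_cast; ring

lemma HasSym.int {a : Module.End K K[X]} {s : ℤ → K[X]} (ha : HasSym a s) :
    HasSym (intOp K * a) (fun k => s (k-1)) := by
  obtain ⟨d, M, h1, h2⟩ := ha
  refine ⟨d+1, M+d+1, fun k hk => h1 _ ?_, fun i hi j => ?_⟩
  · push_cast at hk; grind
  · rw [Module.End.mul_apply]
    cases j with
    | zero =>
      have : s (((0:ℕ):ℤ) - i - 1) = 0 := h1 _ (by grind)
      simp only [this]
      rw [co_int_zero]; simp
    | succ j => rw [co_int_succ, h2 i (by omega)]; congr 2; push_cast; ring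

lemma HasSym.H {a : Module.End K K[X]} {s : ℤ → K[X]} (ha : HasSym a s) :
    HasSym (Hop K * a) (fun k => (X + C ((k:K) + 1)) * s k) := by
  obtain ⟨d, M, h1, h2⟩ := ha
  refine ⟨d, M, fun k hk => ?_, fun i hi j => ?_⟩
  · simp [h1 k hk]
  · rw [Module.End.mul_apply, co_H, h2 i hi]
    simp only [eval_mul, eval_add, eval_X, eval_C]
    push_cast
    ring

lemma exists_sym {a : Module.End K K[X]} (ha : a ∈ I1 K) : ∃ s, HasSym a s := by
  have : ∀ b, (∃ s, HasSym b s) → ∃ s, HasSym (a * b) s := by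
    induction ha using Algebra.adjoin_induction with
    | mem x hx =>
      rintro b ⟨s, hs⟩
      rcases hx with rfl | rfl | rfl
      · rw [x_eq, mul_assoc]; exact ⟨_, hs.H.int⟩
      · exact ⟨_, hs.der⟩
      · exact ⟨_, hs.int⟩
    | algebraMap r =>
      rintro b ⟨s, hs⟩
      rw [← Algebra.smul_def]; exact ⟨_, hs.smul r⟩
    | add x y _ _ hx hy =>
      intro b hb
      obtain ⟨s, hs⟩ := hx b hb
      obtain ⟨t, ht⟩ := hy b hb
      rw [add_mul]; exact ⟨_, hs.add ht⟩
    | mul x y _ _ hx hy =>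
      intro b hb
      rw [mul_assoc]; exact hx _ (hy _ hb)
  simpa using this 1 ⟨_, HasSym.one⟩

lemma poly_ext_of_large {p q : K[X]} (M : ℕ) (h : ∀ i : ℕ, M ≤ i → p.eval (i:K) = q.eval (i:K)) :
    p = q := by
  apply Polynomial.eq_of_infinite_eval_eq
  have : Set.Infinite ((fun i : ℕ => (i : K)) '' Set.Ici M) :=
    (Set.Ici_infinite M).image (Nat.cast_injective.injOn)
  refine this.mono ?_
  rintro _ ⟨i, hi, rfl⟩
  exact h i hi

lemma HasSym.unique {a : Module.End K K[X]} {s t : ℤ → K[X]} (ha : HasSym a s) (hb : HasSym a t) :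
    s = t := by
  obtain ⟨d, M, h1, h2⟩ := ha
  obtain ⟨d', M', h1', h2'⟩ := hb
  funext k
  apply poly_ext_of_large (M + M' + k.natAbs)
  intro i hi
  have e1 := h2 i (by omega) ((i : ℤ) + k).toNat
  have e2 := h2' i (by omega) ((i : ℤ) + k).toNat
  have : (((i : ℤ) + k).toNat : ℤ) - i = k := by omega
  rw [this] at e1 e2
  rw [← e1, e2]

lemma expand {a : Module.End K K[X]} {s : ℤ → K[X]} {d M : ℕ}
    (h1 : ∀ k : ℤ, (d : ℤ) < |k| → s k = 0)
    (h2 : ∀ i, M ≤ i → ∀ j : ℕ, co j (a (bas i)) = (s ((j:ℤ) - i)).eval (i : K))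
    {i : ℕ} (hM : M ≤ i) (hd : d ≤ i) :
    a (bas i) = ∑ m ∈ Finset.Icc (-(d:ℤ)) d, (s m).eval (i:K) • bas ((i:ℤ)+m).toNat := by
  apply co_ext; intro j
  rw [h2 i hM]
  simp only [map_sum, map_smul, co_bas, smul_eq_mul, mul_ite, mul_one, mul_zero]
  rw [Finset.sum_eq_single ((j:ℤ) - i)]
  · rw [if_pos (by omega)]
  · intro m hm hne
    rw [Finset.mem_Icc] at hm
    rw [if_neg (by omega)]
  · intro hm
    rw [Finset.mem_Icc] at hm
    rw [h1 _ (by grind)]; simp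

lemma HasSym.mul {a b : Module.End K K[X]} {s t : ℤ → K[X]} (ha : HasSym a s) (hb : HasSym b t) :
    ∃ d₀ : ℕ, (∀ k : ℤ, (d₀ : ℤ) < |k| → t k = 0) ∧ HasSym (a * b)
      (fun k => ∑ m ∈ Finset.Icc (-(d₀:ℤ)) d₀, (s (k - m)).comp (X + C (m:K)) * t m) := by
  obtain ⟨d, M, h1, h2⟩ := ha
  obtain ⟨d', M', h1', h2'⟩ := hb
  refine ⟨d', h1', d + d', M + M' + d', fun k hk => ?_, fun i hi j => ?_⟩
  · apply Finset.sum_eq_zero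
    intro m hm
    rw [Finset.mem_Icc] at hm
    rw [h1 _ (by push_cast at hk; grind)]; simp
  · rw [Module.End.mul_apply, expand h1' h2' (by omega) (by omega)]
    simp only [map_sum, map_smul, eval_finsetSum, eval_mul, eval_comp, smul_eq_mul]
    apply Finset.sum_congr rfl
    intro m hm
    rw [Finset.mem_Icc] at hm
    rw [h2 _ (by omega), mul_comm]
    have e : (((i:ℤ)+m).toNat : ℤ) = i + m := by omega
    have e2 : (((i:ℤ)+m).toNat : K) = i + m := by exact_mod_cast congrArg (Int.cast (R := K)) e
    rw [e, e2]
    simp [sub_sub]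


lemma sum_one {t f : ℤ → K[X]} {d : ℕ} (h : ∀ k : ℤ, (d : ℤ) < |k| → t k = 0) (b : ℤ)
    (hb : ∀ m, m ≠ b → f m * t m = 0) :
    ∑ m ∈ Finset.Icc (-(d:ℤ)) d, f m * t m = f b * t b := by
  apply Finset.sum_eq_single b
  · intro m _ hm; exact hb m hm
  · intro hm
    rw [Finset.mem_Icc] at hm
    rw [h b (by grind)]; simp

lemma comp_ne {p : K[X]} (hp : p ≠ 0) (c : K) : p.comp (X + C c) ≠ 0 := by
  intro h
  apply hp
  have := congrArg (fun q => q.comp (X - C c)) h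
  simpa [comp_assoc] using this

lemma unit_sym {u w : Module.End K K[X]} {s t : ℤ → K[X]} (huw : u * w = 1)
    (hu : HasSym u s) (hw : HasSym w t) :
    ∃ (n : ℤ) (c : K), c ≠ 0 ∧ s = Pi.single (-n) (C c) ∧ t = Pi.single n (C c⁻¹) := by
  obtain ⟨d, hd, hm⟩ := hu.mul hw
  obtain ⟨d', hd'⟩ : ∃ d' : ℕ, ∀ k : ℤ, (d' : ℤ) < |k| → s k = 0 := by
    obtain ⟨d', _, h, _⟩ := hu; exact ⟨d', h⟩
  rw [huw] at hm
  have E := fun k => congrFun (hm.unique HasSym.one) k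
  have key : ∀ a b : ℤ, (∀ m, m ≠ b → s (a + b - m) = 0 ∨ t m = 0) →
      (s a).comp (X + C (b:K)) * t b = (Pi.single 0 1 : ℤ → K[X]) (a + b) := by
    intro a b h
    rw [← E, sum_one (f := fun m => (s (a + b - m)).comp (X + C (m:K))) hd b]
    · simp
    · intro m hm
      rcases h m hm with h | h <;> simp [h]
  have hs0 : ∃ k, s k ≠ 0 := by
    by_contra! h
    have := E 0
    simp [h] at this
  have ht0 : ∃ k, t k ≠ 0 := by
    by_contra! h
    have := E 0
    simp [h] at this
  have bs : ∀ k, s k ≠ 0 → |k| ≤ d' := fun k hk => by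
    by_contra! h; exact hk (hd' k h)
  have bt : ∀ k, t k ≠ 0 → |k| ≤ d := fun k hk => by
    by_contra! h; exact hk (hd k h)
  obtain ⟨a, ha, ha'⟩ := Int.exists_greatest_of_bdd (P := fun k => s k ≠ 0)
    ⟨d', fun k hk => (abs_le.1 (bs k hk)).2⟩ hs0
  obtain ⟨b, hb, hb'⟩ := Int.exists_greatest_of_bdd (P := fun k => t k ≠ 0)
    ⟨d, fun k hk => (abs_le.1 (bt k hk)).2⟩ ht0
  obtain ⟨a2, ha2, ha2'⟩ := Int.exists_least_of_bdd (P := fun k => s k ≠ 0)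
    ⟨-d', fun k hk => (abs_le.1 (bs k hk)).1⟩ hs0
  obtain ⟨b2, hb2, hb2'⟩ := Int.exists_least_of_bdd (P := fun k => t k ≠ 0)
    ⟨-d, fun k hk => (abs_le.1 (bt k hk)).1⟩ ht0
  have zero_of : ∀ a b : ℤ, s a ≠ 0 → t b ≠ 0 →
      (s a).comp (X + C (b:K)) * t b = (Pi.single 0 1 : ℤ → K[X]) (a + b) → a + b = 0 := by
    intro a b ha hb h
    by_contra hne
    rw [Pi.single_eq_of_ne hne] at h
    exact mul_ne_zero (comp_ne ha _) hb h
  have k1 := key a b (fun m hm => by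
    by_contra! h
    have := ha' _ h.1
    have := hb' _ h.2
    omega)
  have k2 := key a2 b2 (fun m hm => by
    by_contra! h
    have := ha2' _ h.1
    have := hb2' _ h.2
    omega)
  have z1 := zero_of a b ha hb k1
  have z2 := zero_of a2 b2 ha2 hb2 k2
  have := ha2' a ha
  have := hb2' b hb
  have hab : a = -b := by omega
  have hs1 : ∀ k, k ≠ a → s k = 0 := by
    intro k hk
    by_contra h
    have := ha' k h
    have := ha2' k h
    omega
  have ht1 : ∀ k, k ≠ b → t k = 0 := by
    intro k hk
    by_contra h
    have := hb' k h
    have := hb2' k h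
    omega
  rw [z1, Pi.single_eq_same] at k1
  have ut : IsUnit ((s a).comp (X + C (b:K))) := IsUnit.of_mul_eq_one _ k1
  obtain ⟨c, hc, hc'⟩ := Polynomial.isUnit_iff.1 ut
  have hc0 : c ≠ 0 := hc.ne_zero
  refine ⟨b, c, hc0, ?_, ?_⟩
  · have h2 : s a = C c := by
      have := congrArg (fun q => q.comp (X - C (b:K))) hc'
      simpa [comp_assoc] using this.symm
    funext k
    by_cases hk : k = -b
    · subst hk; rw [← hab, h2]; simp
    · rw [Pi.single_eq_of_ne hk, hs1 k (by omega)]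
  · have h2 : t b = C c⁻¹ := by
      rw [← hc'] at k1
      have h3 : C c⁻¹ * (C c * t b) = C c⁻¹ := by rw [k1, mul_one]
      rwa [← mul_assoc, ← C_mul, inv_mul_cancel₀ hc0, C_1, one_mul] at h3
    funext k
    by_cases hk : k = b
    · subst hk; rw [h2]; simp
    · rw [Pi.single_eq_of_ne hk, ht1 k hk]

lemma h_sym {u h : Module.End K K[X]} {p : ℤ → K[X]} {n : ℤ} {c : K} (hc : c ≠ 0)
    (huh : u * h = h * u + u)
    (hu : HasSym u (Pi.single (-n) (C c))) (hh : HasSym h p) (k : ℤ) :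
    p k = (p k).comp (X + C (-(n:K))) + if k = 0 then 1 else 0 := by
  obtain ⟨d, hd, hm⟩ := hu.mul hh
  obtain ⟨d', hd', hm'⟩ := hh.mul hu
  rw [huh] at hm
  have E := congrFun (hm.unique (hm'.add hu)) (k - n)
  simp only [Pi.add_apply] at E
  rw [sum_one (f := fun m => ((Pi.single (-n) (C c) : ℤ → K[X]) (k - n - m)).comp (X + C (m:K))) hd k,
    sum_one (f := fun m => (p (k - n - m)).comp (X + C (m:K))) hd' (-n)] at E
  · have e1 : k - n - k = - n := by ring
    have e2 : k - n - - n = k := by ring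
    rw [e1, e2, Pi.single_eq_same, C_comp] at E
    have e3 : (Pi.single (-n) (C c) : ℤ → K[X]) (k - n) = C c * if k = 0 then 1 else 0 := by
      by_cases hk : k = 0
      · subst hk; simp
      · rw [Pi.single_eq_of_ne (by omega), if_neg hk, mul_zero]
    rw [e3, mul_comm _ (C c), ← mul_add] at E
    have := mul_left_cancel₀ (C_ne_zero.2 hc) E
    push_cast at this
    exact this
  · intro m hm
    rw [Pi.single_eq_of_ne hm, mul_zero]
  · intro m hm
    rw [Pi.single_eq_of_ne (by omega)]; simp

lemma bound {a : Module.End K K[X]} {s : ℤ → K[X]} (ha : HasSym a s) (κ : ℤ)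
    (hκ : ∀ k, κ < k → s k = 0) :
    ∃ L₀ : ℕ, ∀ L, L₀ ≤ L → ∀ v ∈ degreeLT K L, a v ∈ degreeLT K ((L : ℤ) + κ).toNat := by
  obtain ⟨d, M, h1, h2⟩ := ha
  have : ∃ Q, ∀ i < M, a (bas i) ∈ degreeLT K Q := by
    choose f hf using fun i => exists_P (a (bas i))
    refine ⟨∑ i ∈ Finset.range M, f i, fun i hi => P_mono ?_ (hf i)⟩
    exact Finset.single_le_sum (f := f) (fun _ _ => Nat.zero_le _) (Finset.mem_range.2 hi)
  obtain ⟨Q, hQ⟩ := this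
  refine ⟨Q + M + κ.natAbs, fun L hL v hv => ?_⟩
  rw [P_sum hv, map_sum]
  apply Submodule.sum_mem
  intro i hi
  rw [Finset.mem_range] at hi
  rw [map_smul]
  apply Submodule.smul_mem
  by_cases hiM : i < M
  · exact P_mono (by omega) (hQ i hiM)
  · rw [mem_P]
    intro j hj
    rw [h2 i (by omega), hκ _ (by omega)]; simp

lemma nil_lemma {V : Type*} [AddCommGroup V] [Module K V] (u h : Module.End K V)
    (huh : u * h = h * u + u) (P : Submodule K V) [Module.Finite K P]
    (hP : ∀ v ∈ P, u v ∈ P) (hN : ∀ v, ∃ N : ℕ, (u ^ N) v ∈ P) : ∀ v, ∃ N : ℕ, (u ^ N) v = 0 := by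
  let T : Submodule K V :=
    { carrier := {v | ∃ N : ℕ, (u ^ N) v = 0}
      add_mem' := by
        rintro v w ⟨N, hv⟩ ⟨M, hw⟩
        refine ⟨N + M, ?_⟩
        have e1 : (u ^ (N + M)) v = 0 := by
          rw [add_comm, pow_add, Module.End.mul_apply, hv, map_zero]
        have e2 : (u ^ (N + M)) w = 0 := by
          rw [pow_add, Module.End.mul_apply, hw, map_zero]
        rw [map_add, e1, e2, add_zero]
      zero_mem' := ⟨0, by simp⟩
      smul_mem' := by
        rintro c v ⟨N, hv⟩
        exact ⟨N, by simp [hv]⟩ }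
  have memT : ∀ v, v ∈ T ↔ ∃ N : ℕ, (u ^ N) v = 0 := fun v => Iff.rfl
  have huT : T ≤ T.comap u := by
    rintro v ⟨N, hv⟩
    refine ⟨N, ?_⟩
    rw [← Module.End.mul_apply, ← pow_succ, pow_succ', Module.End.mul_apply, hv, map_zero]
  have hpow : ∀ N : ℕ, u ^ N * h = h * u ^ N + (N : K) • u ^ N := by
    intro N
    induction N with
    | zero => simp
    | succ N ih =>
      rw [pow_succ', mul_assoc, ih, mul_add, ← mul_assoc, huh]
      simp only [mul_smul_comm, add_mul, mul_assoc]
      push_cast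
      module
  have hhT : T ≤ T.comap h := by
    rintro v ⟨N, hv⟩
    refine ⟨N, ?_⟩
    rw [← Module.End.mul_apply, hpow]
    simp [hv]
  let u' : Module.End K (V ⧸ T) := T.mapQ T u huT
  let h' : Module.End K (V ⧸ T) := T.mapQ T h hhT
  have hrel : u' * h' = h' * u' + u' := by
    apply LinearMap.ext
    intro q
    obtain ⟨v, rfl⟩ := T.mkQ_surjective q
    have := LinearMap.congr_fun huh v
    simp only [Module.End.mul_apply, LinearMap.add_apply] at this
    simp [u', h', Submodule.mapQ_apply, this]
  have uinj : Function.Injective u' := by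
    rw [injective_iff_map_eq_zero]
    intro q
    obtain ⟨v, rfl⟩ := T.mkQ_surjective q
    simp only [u', Submodule.mkQ_apply, Submodule.mapQ_apply, Submodule.Quotient.mk_eq_zero]
    rintro ⟨N, hv⟩
    exact ⟨N + 1, by rw [pow_succ, Module.End.mul_apply, hv]⟩
  have hpowq : ∀ (N : ℕ) v, (u' ^ N) (T.mkQ v) = T.mkQ ((u ^ N) v) := by
    intro N
    induction N with
    | zero => simp
    | succ N ih =>
      intro v
      rw [pow_succ, pow_succ, Module.End.mul_apply, Module.End.mul_apply, ← ih]
      simp [u']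
  let Q0 : Submodule K (V ⧸ T) := P.map T.mkQ
  have hQ0 : ∀ q ∈ Q0, u' q ∈ Q0 := by
    rintro _ ⟨v, hv, rfl⟩
    exact ⟨u v, hP v hv, by simp [u']⟩
  have hQ0s : ∀ q, u' q ∈ Q0 → q ∈ Q0 := by
    let r : Module.End K Q0 := u'.restrict hQ0
    have rinj : Function.Injective r := by
      intro x y hxy
      apply Subtype.ext
      apply uinj
      exact congrArg Subtype.val hxy
    have rsurj := LinearMap.surjective_of_injective rinj
    intro q hq
    obtain ⟨x, hx⟩ := rsurj ⟨u' q, hq⟩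
    have : u' x = u' q := congrArg Subtype.val hx
    rw [← uinj this]; exact x.2
  have hQtop : ∀ q, q ∈ Q0 := by
    intro q
    obtain ⟨v, rfl⟩ := T.mkQ_surjective q
    obtain ⟨N, hv⟩ := hN v
    have h1 : (u' ^ N) (T.mkQ v) ∈ Q0 := by rw [hpowq]; exact ⟨_, hv, rfl⟩
    clear hv
    generalize T.mkQ v = q at h1
    induction N generalizing q with
    | zero => simpa using h1
    | succ N ih =>
      rw [pow_succ, Module.End.mul_apply] at h1
      exact hQ0s _ (ih _ h1)
  have hfin : FiniteDimensional K (V ⧸ T) := by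
    have : Q0 = ⊤ := by rw [eq_top_iff]; intro q _; exact hQtop q
    have h2 : FiniteDimensional K Q0 := inferInstance
    rw [this] at h2
    exact Module.finite_def.2 (Module.Finite.iff_fg.1 h2)
  have usurj := LinearMap.surjective_of_injective uinj
  let e := LinearEquiv.ofBijective u' ⟨uinj, usurj⟩
  let ui : Module.End K (V ⧸ T) := e.symm.toLinearMap
  have hui : u' * ui = 1 := by
    apply LinearMap.ext; intro q; exact (e.apply_symm_apply _)
  have hui' : ui * u' = 1 := by
    apply LinearMap.ext; intro q; exact (e.symm_apply_apply _)
  have tr : LinearMap.trace K (V ⧸ T) 1 = 0 := by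
    have h1 : u' * h' * ui = h' + 1 := by
      rw [hrel, add_mul, mul_assoc, hui, mul_one]
    have h2 := LinearMap.trace_mul_comm K (u' * h') ui
    rw [h1, ← mul_assoc, hui', one_mul, map_add] at h2
    simpa using h2
  rw [LinearMap.trace_one] at tr
  have fr : Module.finrank K (V ⧸ T) = 0 := by exact_mod_cast tr
  have sub := Module.finrank_zero_iff.1 fr
  intro v
  rw [← memT, ← Submodule.Quotient.mk_eq_zero]
  exact Subsingleton.elim _ _

/-- products of `h - (m+1)` -/
def opl (h : Module.End K K[X]) (l : List ℕ) : Module.End K K[X] :=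
  (l.map (fun m : ℕ => h - ((m:K) + 1) • (1 : Module.End K K[X]))).prod

lemma opl_cons (h : Module.End K K[X]) (m : ℕ) (l : List ℕ) (v : K[X]) :
    opl h (m :: l) v = (h - ((m:K) + 1) • (1 : Module.End K K[X])) (opl h l v) := by
  simp [opl]

lemma opl_shift {u h : Module.End K K[X]} (huh : u * h = h * u + u) (l : List ℕ) (v : K[X]) :
    u (opl h (l.map Nat.succ) v) = opl h l (u v) := by
  induction l with
  | nil => simp [opl]
  | cons m l ih =>
    rw [List.map_cons, opl_cons, opl_cons, ← ih]
    have := LinearMap.congr_fun huh (opl h (l.map Nat.succ) v)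
    simp only [Module.End.mul_apply, LinearMap.add_apply] at this
    simp [this]
    module

lemma exists_opl {u w h : Module.End K K[X]} (huh : u * h = h * u + u)
    (hhe : h * (1 - w * u) = 1 - w * u) (N : ℕ) :
    ∀ v, (u ^ N) v = 0 → ∃ l, opl h l v = 0 := by
  induction N with
  | zero => intro v hv; exact ⟨[], by simpa [opl] using hv⟩
  | succ N ih =>
    intro v hv
    rw [pow_succ, Module.End.mul_apply] at hv
    obtain ⟨l, hl⟩ := ih _ hv
    refine ⟨0 :: l.map Nat.succ, ?_⟩
    rw [← opl_shift huh] at hl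
    rw [opl_cons]
    have := LinearMap.congr_fun hhe (opl h (l.map Nat.succ) v)
    simp only [Module.End.mul_apply, LinearMap.sub_apply, Module.End.one_apply, hl, map_zero,
      sub_zero] at this
    simp [this]

lemma lead {h : Module.End K K[X]} {p : ℤ → K[X]} (hh : HasSym h p) (κ : ℕ)
    (hκ : ∀ k : ℤ, (κ:ℤ) < k → p k = 0) :
    ∃ L₀ : ℕ, ∀ L, L₀ ≤ L → ∀ v ∈ degreeLT K (L+1), ∀ m : ℕ,
      (h - ((m:K) + 1) • (1 : Module.End K K[X])) v ∈ degreeLT K (L + κ + 1) ∧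
      co (L + κ) ((h - ((m:K) + 1) • (1 : Module.End K K[X])) v) =
        ((p κ).eval (L:K) - if κ = 0 then (m:K) + 1 else 0) * co L v := by
  obtain ⟨L₀, hL₀⟩ := bound hh κ hκ
  obtain ⟨d, M, h1, h2⟩ := hh
  refine ⟨L₀ + M, fun L hL v hv m => ?_⟩
  have e1 := hL₀ (L+1) (by omega) v hv
  have e1' : (((L+1:ℕ):ℤ) + κ).toNat = L + κ + 1 := by omega
  rw [e1'] at e1
  constructor
  · simp only [LinearMap.sub_apply, LinearMap.smul_apply, Module.End.one_apply]
    exact Submodule.sub_mem _ e1 (Submodule.smul_mem _ _ (P_mono (by omega) hv))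
  · have hv' : v - co L v • bas L ∈ degreeLT K L := by
      rw [mem_P] at hv ⊢
      intro j hj
      rw [map_sub, map_smul, co_bas]
      split_ifs with hLj
      · subst hLj; simp
      · rw [hv j (by omega)]; simp
    have e2 := hL₀ L (by omega) _ hv'
    have e2' : ((L:ℤ) + κ).toNat = L + κ := by omega
    rw [e2', mem_P] at e2
    have e3 := e2 (L + κ) le_rfl
    have e4 := h2 L (by omega) (L + κ)
    have e4' : ((L + κ : ℕ) : ℤ) - L = κ := by push_cast; ring
    rw [e4'] at e4
    rw [map_sub, map_smul, map_sub, map_smul, e4, smul_eq_mul, sub_eq_zero] at e3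
    simp only [LinearMap.sub_apply, LinearMap.smul_apply, Module.End.one_apply, map_sub, map_smul,
      smul_eq_mul, e3]
    split_ifs with hk
    · subst hk; simp; ring
    · rw [mem_P] at hv
      rw [hv (L + κ) (by omega)]; ring

lemma opl_ne {h : Module.End K K[X]} {κ L₀ : ℕ} {q : K[X]}
    (hL : ∀ L, L₀ ≤ L → ∀ v ∈ degreeLT K (L+1), ∀ m : ℕ,
      (h - ((m:K) + 1) • (1 : Module.End K K[X])) v ∈ degreeLT K (L + κ + 1) ∧
      co (L + κ) ((h - ((m:K) + 1) • (1 : Module.End K K[X])) v) =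
        (q.eval (L:K) - if κ = 0 then (m:K) + 1 else 0) * co L v)
    {L : ℕ} (hL₀ : L₀ ≤ L)
    (hgood : ∀ (r m : ℕ), q.eval ((L + κ * r : ℕ):K) - (if κ = 0 then (m:K) + 1 else 0) ≠ 0)
    (l : List ℕ) : opl h l (bas L) ∈ degreeLT K (L + κ * l.length + 1) ∧
      co (L + κ * l.length) (opl h l (bas L)) ≠ 0 := by
  induction l with
  | nil => simp [opl, co_bas]; exact bas_mem_P (by omega)
  | cons m l ih =>
    have := hL (L + κ * l.length) (by nlinarith [Nat.zero_le (κ * l.length)]) _ ih.1 m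
    have e : L + κ * l.length + κ = L + κ * (m :: l).length := by simp; ring
    rw [e] at this
    rw [opl_cons]
    refine ⟨this.1, ?_⟩
    rw [this.2]
    exact mul_ne_zero (hgood _ _) ih.2

lemma periodic_const {q : K[X]} {n : ℤ} (hn : n ≠ 0) (h : q = q.comp (X + C (-(n:K)))) :
    q = C (q.eval 0) := by
  have h1 : ∀ i : ℕ, q.eval ((n:K) * i) = q.eval 0 := by
    intro i
    induction i with
    | zero => simp
    | succ i ih =>
      rw [← ih]
      conv_lhs => rw [h, eval_comp]
      congr 1
      simp; ring
  apply Polynomial.eq_of_infinite_eval_eq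
  have : Set.Infinite (Set.range (fun i : ℕ => (n:K) * i)) := by
    apply Set.infinite_range_of_injective
    intro i j hij
    have hn' : (n:K) ≠ 0 := Int.cast_ne_zero.2 hn
    exact_mod_cast mul_left_cancel₀ hn' hij
  refine this.mono ?_
  rintro _ ⟨i, rfl⟩
  simp [h1]

lemma eventually_ne {q : K[X]} (hq : q ≠ 0) : ∃ M : ℕ, ∀ i : ℕ, M ≤ i → q.eval (i:K) ≠ 0 := by
  by_contra! h
  apply hq
  have hinf : Set.Infinite {i : ℕ | q.eval (i:K) = 0} := by
    rw [← Nat.frequently_atTop_iff_infinite, Filter.frequently_atTop]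
    intro M
    obtain ⟨i, h1, h2⟩ := h M
    exact ⟨i, h1, h2⟩
  apply Polynomial.eq_zero_of_infinite_isRoot
  refine (hinf.image (Nat.cast_injective (R := K)).injOn).mono ?_
  rintro _ ⟨i, hi, rfl⟩
  exact hi

lemma n_eq_one {u w h : Module.End K K[X]} {p : ℤ → K[X]} {n : ℤ} (hn : 0 < n)
    (huh : u * h = h * u + u) (hhe : h * (1 - w * u) = 1 - w * u)
    (hloc : ∀ v, ∃ N : ℕ, (u ^ N) v = 0) (hh : HasSym h p)
    (hp : ∀ k, p k = (p k).comp (X + C (-(n:K))) + if k = 0 then 1 else 0) : n = 1 := by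
  have hp0 := hp 0
  rw [if_pos rfl] at hp0
  have p0 : p 0 ≠ 0 := by intro h0; rw [h0] at hp0; simp at hp0
  obtain ⟨d, hd⟩ : ∃ d : ℕ, ∀ k : ℤ, (d : ℤ) < |k| → p k = 0 := by
    obtain ⟨d', _, h, _⟩ := hh; exact ⟨d', h⟩
  obtain ⟨a, ha, ha'⟩ := Int.exists_greatest_of_bdd (P := fun k => p k ≠ 0)
    ⟨d, fun k hk => by
      by_contra! h; exact hk (hd k (lt_of_lt_of_le h (le_abs_self k)))⟩ ⟨0, p0⟩
  obtain ⟨κ, rfl⟩ := Int.eq_ofNat_of_zero_le (ha' 0 p0)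
  obtain ⟨L₀, hL₀⟩ := lead hh κ (fun k hk => by
    by_contra h; have := ha' k h; omega)
  have hbad : ∀ L, L₀ ≤ L → ∃ r m : ℕ,
      (p κ).eval ((L + κ * r : ℕ):K) - (if κ = 0 then (m:K) + 1 else 0) = 0 := by
    intro L hL
    by_contra! hgood
    obtain ⟨N, hN⟩ := hloc (bas L)
    obtain ⟨l, hl⟩ := exists_opl huh hhe N _ hN
    have := (opl_ne hL₀ hL hgood l).2
    rw [hl] at this
    simp at this
  by_cases hκ : κ = 0
  · subst hκ
    have hev : ∀ L, L₀ ≤ L → ∃ m : ℕ, (p 0).eval (L:K) = m + 1 := by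
      intro L hL
      obtain ⟨r, m, h⟩ := hbad L hL
      refine ⟨m, ?_⟩
      simpa [sub_eq_zero] using h
    have hr := periodic_const (q := C (n:K) * p 0 - X) hn.ne' (by
      conv_lhs => rw [hp0]
      simp
      ring)
    obtain ⟨m1, h1⟩ := hev L₀ le_rfl
    obtain ⟨m2, h2⟩ := hev (L₀+1) (by omega)
    have e1 := congrArg (eval (L₀:K)) hr
    have e2 := congrArg (eval ((L₀+1:ℕ):K)) hr
    simp only [eval_sub, eval_mul, eval_C, eval_X, h1, h2] at e1 e2
    have e3 : (n:K) * ((m2:K) - m1) = 1 := by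
      rw [← e2] at e1; push_cast at e1; linear_combination -e1
    have e4 : n * ((m2:ℤ) - m1) = 1 := by exact_mod_cast e3
    rcases Int.eq_one_or_neg_one_of_mul_eq_one e4 with h | h <;> omega
  · exfalso
    obtain ⟨M, hM⟩ := eventually_ne ha
    obtain ⟨r, m, h⟩ := hbad (L₀ + M) (by omega)
    rw [if_neg hκ, sub_zero] at h
    exact hM _ (by nlinarith [Nat.zero_le (κ * r)]) h

lemma finrank_P (L : ℕ) : Module.finrank K (degreeLT K L) = L := by
  rw [(degreeLTEquiv K L).finrank_eq]; simp

instance fin_P (L : ℕ) : FiniteDimensional K (degreeLT K L) :=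
  Module.Finite.equiv (degreeLTEquiv K L).symm

lemma single_bound (n : ℤ) (c : K) : ∀ k, n < k → (Pi.single n (C c) : ℤ → K[X]) k = 0 := by
  intro k hk
  exact Pi.single_eq_of_ne (by omega) _

lemma n_nonneg {u w : Module.End K K[X]} {n : ℤ} {c : K} (huw : u * w = 1)
    (hw : HasSym w (Pi.single n (C c))) : 0 ≤ n := by
  by_contra! hn
  obtain ⟨L₀, hL⟩ := bound hw n (single_bound n c)
  have := hL (L₀ + n.natAbs) (by omega)
  set L := L₀ + n.natAbs with hLdef
  let f : degreeLT K L →ₗ[K] degreeLT K ((L:ℤ) + n).toNat := w.restrict this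
  have finj : Function.Injective f := by
    intro x y hxy
    have h1 : w x = w y := congrArg Subtype.val hxy
    have h2 := congrArg u h1
    rw [← Module.End.mul_apply, ← Module.End.mul_apply, huw] at h2
    exact Subtype.ext h2
  have := LinearMap.finrank_le_finrank_of_injective finj
  rw [finrank_P, finrank_P] at this
  omega

lemma loc_nil {u h : Module.End K K[X]} {n : ℤ} {c : K} (hn : 0 < n)
    (huh : u * h = h * u + u) (hu : HasSym u (Pi.single (-n) (C c))) :
    ∀ v, ∃ N : ℕ, (u ^ N) v = 0 := by
  obtain ⟨L₀, hL⟩ := bound hu (-n) (single_bound _ c)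
  apply nil_lemma u h huh (degreeLT K L₀)
  · intro v hv
    exact P_mono (by omega) (hL L₀ le_rfl v hv)
  · intro v
    have : ∀ N : ℕ, ∀ v ∈ degreeLT K (L₀ + N), (u ^ N) v ∈ degreeLT K L₀ := by
      intro N
      induction N with
      | zero => intro v hv; simpa using hv
      | succ N ih =>
        intro v hv
        rw [pow_succ, Module.End.mul_apply]
        exact ih _ (P_mono (by omega) (hL _ (by omega) v hv))
    obtain ⟨N, hN⟩ := exists_P v
    exact ⟨N, this N v (P_mono (by omega) hN)⟩

lemma ker_gen {V W : Type*} [AddCommGroup V] [Module K V] [AddCommGroup W] [Module K W]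
    [FiniteDimensional K V] (f : V →ₗ[K] W)
    (hf : Module.finrank K V = Module.finrank K (LinearMap.range f) + 1) :
    ∃ y, y ≠ 0 ∧ f y = 0 ∧ ∀ v, f v = 0 → ∃ r : K, v = r • y := by
  have := LinearMap.finrank_range_add_finrank_ker f
  obtain ⟨y, hy, hy'⟩ := finrank_eq_one_iff'.1
    (show Module.finrank K (LinearMap.ker f) = 1 by omega)
  refine ⟨y, fun h => hy (Subtype.ext h), y.2, fun v hv => ?_⟩
  obtain ⟨r, hr⟩ := hy' ⟨v, hv⟩
  exact ⟨r, (congrArg Subtype.val hr).symm⟩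

lemma ker_one {u w : Module.End K K[X]} {c c' : K} (huw : u * w = 1)
    (hu : HasSym u (Pi.single (-1) (C c))) (hw : HasSym w (Pi.single 1 (C c'))) :
    ∃ y, y ≠ 0 ∧ u y = 0 ∧ ∀ v, u v = 0 → ∃ r : K, v = r • y := by
  obtain ⟨L₁, hL₁⟩ := bound hu (-1) (single_bound _ c)
  obtain ⟨L₂, hL₂⟩ := bound hw 1 (single_bound _ c')
  have one : ∀ L, L₁ + L₂ ≤ L → ∃ y ∈ degreeLT K (L+1), y ≠ 0 ∧ u y = 0 ∧
      ∀ v ∈ degreeLT K (L+1), u v = 0 → ∃ r : K, v = r • y := by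
    intro L hL
    have hr : LinearMap.range (u.domRestrict (degreeLT K (L+1))) = degreeLT K L := by
      apply le_antisymm
      · rintro _ ⟨⟨v, hv⟩, rfl⟩
        exact P_mono (by omega) (hL₁ (L+1) (by omega) v hv)
      · intro v hv
        refine ⟨⟨w v, P_mono (by omega) (hL₂ L (by omega) v hv)⟩, ?_⟩
        exact LinearMap.congr_fun huw v
    obtain ⟨y, hy, huy, hy'⟩ := ker_gen (u.domRestrict (degreeLT K (L+1)))
      (by rw [hr, finrank_P, finrank_P])
    refine ⟨y, y.2, ?_, huy, ?_⟩
    · intro h; apply hy; exact Subtype.ext h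
    · intro v hv huv
      obtain ⟨r, hr⟩ := hy' ⟨v, hv⟩ huv
      exact ⟨r, congrArg Subtype.val hr⟩
  obtain ⟨y, hyL, hy0, huy, hy⟩ := one (L₁ + L₂) le_rfl
  refine ⟨y, hy0, huy, fun v hv => ?_⟩
  obtain ⟨M, hM⟩ := exists_P v
  obtain ⟨z, hzL, hz0, huz, hz⟩ := one (L₁ + L₂ + M) (by omega)
  obtain ⟨r, hr⟩ := hz v (P_mono (by omega) hM) hv
  obtain ⟨t, ht⟩ := hz y (P_mono (by omega) hyL) huy
  have ht0 : t ≠ 0 := by rintro rfl; simp at ht; exact hy0 ht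
  refine ⟨r * t⁻¹, ?_⟩
  rw [ht, smul_smul, mul_assoc, inv_mul_cancel₀ ht0, mul_one, hr]

/-- functionals of finite support -/
def Vd : Submodule K (K[X] →ₗ[K] K) where
  carrier := {ξ | ∃ M : ℕ, ∀ i, M ≤ i → ξ (bas i) = 0}
  add_mem' := by
    rintro ξ η ⟨M, hM⟩ ⟨N, hN⟩
    exact ⟨M + N, fun i hi => by simp [hM i (by omega), hN i (by omega)]⟩
  zero_mem' := ⟨0, by simp⟩
  smul_mem' := by
    rintro c ξ ⟨M, hM⟩
    exact ⟨M, fun i hi => by simp [hM i hi]⟩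

/-- functionals supported below M -/
def Pd (M : ℕ) : Submodule K (Vd (K := K)) where
  carrier := {ξ | ∀ i, M ≤ i → ξ.1 (bas i) = 0}
  add_mem' := by
    intro ξ η hM hN i hi
    simp [hM i hi, hN i hi]
  zero_mem' := by simp
  smul_mem' := by
    intro c ξ hM i hi
    simp [hM i hi]

instance fin_Pd (M : ℕ) : Module.Finite K (Pd (K := K) M) := by
  let f : Pd (K := K) M →ₗ[K] (Fin M → K) :=
    { toFun := fun ξ i => ξ.1.1 (bas i)
      map_add' := fun _ _ => rfl
      map_smul' := fun _ _ => rfl }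
  apply Module.Finite.of_injective f
  intro ξ η h
  apply Subtype.ext
  apply Subtype.ext
  apply bas.ext
  intro i
  by_cases hi : i < M
  · exact congrFun h ⟨i, hi⟩
  · rw [ξ.2 i (by omega), η.2 i (by omega)]

lemma Vd_dual {a : Module.End K K[X]} {s : ℤ → K[X]} (ha : HasSym a s) :
    ∀ ξ ∈ Vd (K := K), a.dualMap ξ ∈ Vd (K := K) := by
  rintro ξ ⟨N, hN⟩
  obtain ⟨d, M, h1, h2⟩ := ha
  refine ⟨N + M + d, fun i hi => ?_⟩
  rw [LinearMap.dualMap_apply, expand h1 h2 (by omega) (by omega), map_sum]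
  apply Finset.sum_eq_zero
  intro m hm
  rw [Finset.mem_Icc] at hm
  rw [map_smul, hN _ (by omega), smul_zero]

lemma shift_bas {w : Module.End K K[X]} {n : ℤ} {c : K} (hw : HasSym w (Pi.single n (C c))) :
    ∃ M : ℕ, ∀ i, M ≤ i → w (bas i) = c • bas ((i:ℤ) + n).toNat := by
  obtain ⟨d, M, h1, h2⟩ := hw
  refine ⟨M + n.natAbs, fun i hi => ?_⟩
  apply co_ext; intro j
  rw [h2 i (by omega), map_smul, co_bas]
  split_ifs with h
  · have : (j:ℤ) - i = n := by omega
    rw [this]; simp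
  · rw [Pi.single_eq_of_ne (by omega)]; simp

lemma dual_nil {w h : Module.End K K[X]} {p : ℤ → K[X]} {c : K}
    (hhw : h * w = w * h + w) (hw : HasSym w (Pi.single 1 (C c))) (hh : HasSym h p) (j : ℕ) :
    ∃ N : ℕ, ∀ v, co j ((w ^ N) v) = 0 := by
  obtain ⟨M, hM⟩ := shift_bas hw
  let U : Module.End K (Vd (K := K)) := w.dualMap.restrict (Vd_dual hw)
  let H : Module.End K (Vd (K := K)) := h.dualMap.restrict (Vd_dual hh)
  have hU : ∀ (ξ : Vd (K := K)) v, (U ξ).1 v = ξ.1 (w v) := fun _ _ => rfl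
  have hH : ∀ (ξ : Vd (K := K)) v, (H ξ).1 v = ξ.1 (h v) := fun _ _ => rfl
  have hUp : ∀ (N : ℕ) (ξ : Vd (K := K)) v, ((U ^ N) ξ).1 v = ξ.1 ((w ^ N) v) := by
    intro N
    induction N with
    | zero => intro ξ v; simp
    | succ N ih => intro ξ v; rw [pow_succ, Module.End.mul_apply, ih, hU, pow_succ', Module.End.mul_apply]
  have hUM : ∀ i, M ≤ i → w (bas i) = c • bas (i+1) := by
    intro i hi
    rw [hM i hi]; congr 2
  have rel : U * H = H * U + U := by
    apply LinearMap.ext; intro ξ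
    apply Subtype.ext
    apply LinearMap.ext; intro v
    have := LinearMap.congr_fun hhw v
    simp only [Module.End.mul_apply, LinearMap.add_apply] at this
    simp only [Module.End.mul_apply, LinearMap.add_apply, Submodule.coe_add]
    rw [hU, hH, hH, hU, hU, this, map_add]
  have key := nil_lemma (V := Vd (K := K)) U H rel (Pd (K := K) M) (by
      intro ξ hξ i hi
      rw [hU, hUM i hi, map_smul, hξ _ (by omega), smul_zero]) (by
      have : ∀ N : ℕ, ∀ ξ ∈ Pd (K := K) (M + N), (U ^ N) ξ ∈ Pd (K := K) M := by
        intro N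
        induction N with
        | zero => intro ξ hξ; simpa using hξ
        | succ N ih =>
          intro ξ hξ
          rw [pow_succ, Module.End.mul_apply]
          apply ih
          intro i hi
          rw [hU, hUM i (by omega), map_smul, hξ _ (by omega), smul_zero]
      intro ξ
      obtain ⟨N, hN⟩ := ξ.2
      exact ⟨N, this N ξ (fun i hi => hN i (by omega))⟩)
  obtain ⟨N, hN⟩ := key ⟨co j, j+1, fun i hi => by rw [co_bas, if_neg (by omega)]⟩
  refine ⟨N, fun v => ?_⟩
  have := hUp N ⟨co j, j+1, fun i hi => by rw [co_bas, if_neg (by omega)]⟩ v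
  rw [hN] at this
  exact this.symm

lemma F_le {u w : Module.End K K[X]} (R : Subalgebra K (Module.End K K[X])) (hu : u ∈ R)
    (hw : w ∈ R) (huw : u * w = 1) (hloc : ∀ v, ∃ N : ℕ, (u ^ N) v = 0)
    (hd : ∀ j, ∃ N : ℕ, ∀ v, co j ((w ^ N) v) = 0)
    (hy : ∃ y, ∀ v, u v = 0 → ∃ r : K, v = r • y)
    {f : Module.End K K[X]} {M : ℕ} (hf : ∀ i, M ≤ i → f (bas i) = 0) : f ∈ R := by
  obtain ⟨y, hy⟩ := hy
  choose N1 hN1 using fun j => hloc (f (bas j))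
  choose N2 hN2 using hd
  set N := ∑ j ∈ Finset.range M, (N1 j + N2 j) with hN
  have hle : ∀ j < M, N1 j + N2 j ≤ N := fun j hj =>
    Finset.single_le_sum (f := fun j => N1 j + N2 j) (fun _ _ => Nat.zero_le _) (Finset.mem_range.2 hj)
  have huf : u ^ N * f = 0 := by
    apply bas.ext; intro j
    by_cases hj : j < M
    · obtain ⟨t, ht⟩ := Nat.exists_eq_add_of_le (show N1 j ≤ N by have := hle j hj; omega)
      rw [Module.End.mul_apply, ht, add_comm, pow_add, Module.End.mul_apply, hN1]; simp
    · simp [hf j (by omega)]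
  have hfexp : ∀ v, f v = ∑ j ∈ Finset.range M, co j v • f (bas j) := by
    have : f = ∑ j ∈ Finset.range M, (co j).smulRight (f (bas j)) := by
      apply bas.ext; intro i
      simp only [LinearMap.sum_apply, LinearMap.smulRight_apply, co_bas, ite_smul, one_smul, zero_smul]
      rw [Finset.sum_ite_eq (Finset.range M) i]
      split_ifs with h
      · rfl
      · exact hf i (by simpa using h)
    intro v
    conv_lhs => rw [this]
    simp
  have hfw : f * w ^ N = 0 := by
    apply LinearMap.ext; intro v
    rw [Module.End.mul_apply, hfexp]
    apply Finset.sum_eq_zero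
    intro j hj
    have hj := Finset.mem_range.1 hj
    obtain ⟨t, ht⟩ := Nat.exists_eq_add_of_le (show N2 j ≤ N by have := hle j hj; omega)
    rw [ht, pow_add, Module.End.mul_apply, hN2, zero_smul]
  set π := 1 - w * u with hπ
  have uπ : u * π = 0 := by rw [hπ, mul_sub, ← mul_assoc, huw]; simp
  have πR : π ∈ R := sub_mem (one_mem _) (mul_mem hw hu)
  have hε : ∀ N : ℕ, 1 - w ^ N * u ^ N = ∑ i ∈ Finset.range N, w ^ i * π * u ^ i := by
    intro N
    induction N with
    | zero => simp
    | succ N ih =>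
      rw [Finset.sum_range_succ, ← ih, hπ, pow_succ, pow_succ']
      simp only [mul_sub, sub_mul, mul_one, mul_assoc]
      abel
  have hrank : ∀ g : Module.End K K[X], ∃ r : K, π * g * π = r • π := by
    intro g
    have hu0 : ∀ v, u (π v) = 0 := fun v => LinearMap.congr_fun uπ v
    obtain ⟨r, hr⟩ := hy (π (g y)) (hu0 _)
    refine ⟨r, ?_⟩
    apply LinearMap.ext; intro v
    obtain ⟨t, ht⟩ := hy (π v) (hu0 _)
    simp only [Module.End.mul_apply, LinearMap.smul_apply]
    rw [ht, map_smul, map_smul, hr, smul_comm]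
  have hff : f = (1 - w ^ N * u ^ N) * f * (1 - w ^ N * u ^ N) := by
    have : (1 - w ^ N * u ^ N) * f = f := by rw [sub_mul, mul_assoc, huf]; simp
    rw [this, mul_sub, ← mul_assoc, hfw]; simp
  rw [hff, hε, Finset.sum_mul, Finset.sum_mul]
  apply sum_mem
  intro i _
  rw [Finset.mul_sum]
  apply sum_mem
  intro j _
  obtain ⟨r, hr⟩ := hrank (u ^ i * f * w ^ j)
  have : w ^ i * π * u ^ i * f * (w ^ j * π * u ^ j) = w ^ i * (π * (u ^ i * f * w ^ j) * π) * u ^ j := by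
    simp only [mul_assoc]
  rw [this, hr]
  exact mul_mem (mul_mem (pow_mem hw _) (Subalgebra.smul_mem _ πR _)) (pow_mem hu _)

/-- shifts -/
def Sh (k : ℤ) : Module.End K K[X] := if 0 ≤ k then intOp K ^ k.toNat else derOp K ^ (-k).toNat

lemma int_pow_bas (k i : ℕ) : (intOp K ^ k) (bas i) = bas (i + k) := by
  induction k generalizing i with
  | zero => simp
  | succ k ih => rw [pow_succ, Module.End.mul_apply, int_bas, ih]; congr 1; omega

lemma der_pow_bas (k i : ℕ) : (derOp K ^ k) (bas (i + k)) = bas i := by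
  induction k generalizing i with
  | zero => simp
  | succ k ih => rw [pow_succ, Module.End.mul_apply, ← add_assoc, der_bas_succ, ih]

lemma Sh_bas (k : ℤ) (i : ℕ) (h : 0 ≤ (i:ℤ) + k) : Sh k (bas i : K[X]) = bas ((i:ℤ)+k).toNat := by
  unfold Sh
  split_ifs with hk
  · rw [int_pow_bas]; congr 1; omega
  · obtain ⟨t, ht⟩ : ∃ t, i = t + (-k).toNat := ⟨i - (-k).toNat, by omega⟩
    conv_lhs => rw [ht]
    rw [der_pow_bas]; congr 1; omega

lemma H_mem_of {h : Module.End K K[X]} {p : ℤ → K[X]} (R : Subalgebra K (Module.End K K[X]))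
    (hF : ∀ (f : Module.End K K[X]) (M : ℕ), (∀ i, M ≤ i → f (bas i) = 0) → f ∈ R)
    (hder : derOp K ∈ R) (hint : intOp K ∈ R) (hhR : h ∈ R) (hh : HasSym h p)
    (hp : ∀ k, p k = (p k).comp (X + C (-((1:ℤ):K))) + if k = 0 then 1 else 0) : Hop K ∈ R := by
  have hH := (HasSym.one (K := K)).H.smul (-1)
  have hg := hh.add hH
  set q := p + (-1:K) • (fun k : ℤ => (X + C ((k:K) + 1)) * (Pi.single 0 1 : ℤ → K[X]) k) with hq
  have hqc : ∀ k, q k = C ((q k).eval 0) := by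
    intro k
    apply periodic_const (n := 1) one_ne_zero
    by_cases hk : k = 0
    · subst hk
      have := hp 0
      simp only [hq, Pi.add_apply, Pi.smul_apply, Pi.single_eq_same]
      conv_lhs => rw [this]
      simp
      ring
    · have := hp k
      rw [if_neg hk, add_zero] at this
      have e : q k = p k := by simp [hq, Pi.single_eq_of_ne hk]
      rw [e]; exact this
  obtain ⟨d, M, h1, h2⟩ := hg
  have hS : ∀ k, (Sh k : Module.End K K[X]) ∈ R := by
    intro k; unfold Sh; split_ifs
    · exact pow_mem hint _
    · exact pow_mem hder _
  have hmem := hF (h + (-1:K) • (Hop K * 1) - ∑ m ∈ Finset.Icc (-(d:ℤ)) d, (q m).eval 0 • Sh m) (M + d) (by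
    intro i hi
    rw [LinearMap.sub_apply, expand h1 h2 (by omega) (by omega), LinearMap.sum_apply, sub_eq_zero]
    apply Finset.sum_congr rfl
    intro m hm
    rw [Finset.mem_Icc] at hm
    rw [LinearMap.smul_apply, Sh_bas _ _ (by omega)]
    congr 1
    conv_lhs => rw [hqc m]
    simp)
  have hsum : ∑ m ∈ Finset.Icc (-(d:ℤ)) d, (q m).eval 0 • Sh m ∈ R :=
    sum_mem fun m _ => Subalgebra.smul_mem _ (hS m) _
  have := sub_mem hhR (add_mem hmem hsum)
  have e : Hop K = h - (h + (-1:K) • (Hop K * 1) - ∑ m ∈ Finset.Icc (-(d:ℤ)) d, (q m).eval 0 • Sh m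
      + ∑ m ∈ Finset.Icc (-(d:ℤ)) d, (q m).eval 0 • Sh m) := by
    rw [mul_one]; module
  rw [e]; exact this

lemma mem_of_shift {u : Module.End K K[X]} (R : Subalgebra K (Module.End K K[X]))
    (hF : ∀ (f : Module.End K K[X]) (M : ℕ), (∀ i, M ≤ i → f (bas i) = 0) → f ∈ R)
    {n : ℤ} {c : K} (hc : c ≠ 0) (huR : u ∈ R) (hu : HasSym u (Pi.single n (C c))) : Sh n ∈ R := by
  obtain ⟨M, hM⟩ := shift_bas hu
  have h1 := hF (u - c • Sh n) (M + n.natAbs) (by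
    intro i hi
    rw [LinearMap.sub_apply, hM i (by omega), LinearMap.smul_apply, Sh_bas _ _ (by omega), sub_self])
  have h2 := Subalgebra.smul_mem _ (sub_mem huR h1) c⁻¹
  simpa [smul_smul, hc] using h2

end aux

/-- Every `K`-algebra endomorphism of the algebra `I₁` of polynomial
integro-differential operators is bijective, i.e. is a `K`-algebra automorphism of `I₁`. -/
theorem every_algEndomorphism_of_I1_is_automorphism (σ : I1 K →ₐ[K] I1 K) :
    Function.Bijective σ := by
  set τ : I1 K →ₐ[K] Module.End K K[X] := (I1 K).val.comp σ with hτ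
  have hτi : ∀ a, τ a = (σ a : Module.End K K[X]) := fun a => rfl
  set R := τ.range with hR
  have hmemR : ∀ a, τ a ∈ R := fun a => ⟨a, rfl⟩
  set u := τ (DelI K) with hu
  set w := τ (IntI K) with hw
  set h := τ (HelI K) with hh
  have huw : u * w = 1 := by
    rw [hu, hw, ← map_mul, ← map_one τ]; congr 1; exact Subtype.ext der_int
  have huh : u * h = h * u + u := by
    rw [hu, hh, ← map_mul, ← map_mul, ← map_add]; congr 1; exact Subtype.ext H_der
  have hhw : h * w = w * h + w := by
    rw [hw, hh, ← map_mul, ← map_mul, ← map_add]; congr 1; exact Subtype.ext H_int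
  have hhe : h * (1 - w * u) = 1 - w * u := by
    rw [hw, hu, hh, ← map_mul, ← map_one τ, ← map_sub, ← map_mul]; congr 1; exact Subtype.ext H_e
  obtain ⟨s, hs⟩ := exists_sym (σ (DelI K)).2
  obtain ⟨t, ht⟩ := exists_sym (σ (IntI K)).2
  obtain ⟨p, hp⟩ := exists_sym (σ (HelI K)).2
  change HasSym u s at hs
  change HasSym w t at ht
  change HasSym h p at hp
  obtain ⟨n, c, hc, rfl, rfl⟩ := unit_sym huw hs ht
  have hpk := h_sym hc huh hs hp
  have hn0 := n_nonneg huw ht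
  have hn : n ≠ 0 := by
    rintro rfl
    have := hpk 0
    simp at this
  have hloc := loc_nil (lt_of_le_of_ne hn0 hn.symm) huh hs
  have hn1 := n_eq_one (lt_of_le_of_ne hn0 hn.symm) huh hhe hloc hp hpk
  subst hn1
  obtain ⟨y, hy0, huy, hy⟩ := ker_one huw hs ht
  have hd := dual_nil hhw ht hp
  have hF : ∀ (f : Module.End K K[X]) (M : ℕ), (∀ i, M ≤ i → f (bas i) = 0) → f ∈ R :=
    fun f M hf => F_le R (hmemR _) (hmemR _) huw hloc hd ⟨y, hy⟩ hf
  have hder : derOp K ∈ R := by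
    simpa [Sh] using mem_of_shift R hF hc (hmemR (DelI K)) hs
  have hint : intOp K ∈ R := by
    simpa [Sh] using mem_of_shift R hF (inv_ne_zero hc) (hmemR (IntI K)) ht
  have hH : Hop K ∈ R := H_mem_of R hF hder hint (hmemR (HelI K)) hp hpk
  have hx : xOp K ∈ R := by rw [x_eq]; exact mul_mem hint hH
  constructor
  · rw [injective_iff_map_eq_zero]
    intro a ha
    by_contra hne
    have : ∃ i j, co j (a.1 (bas i)) ≠ 0 := by
      by_contra! hz
      apply hne
      apply Subtype.ext
      apply bas.ext; intro i
      apply co_ext; intro j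
      rw [hz i j]; simp
    obtain ⟨i, j, hij⟩ := this
    have hE : (eOp K 0 j * a.1 * eOp K i 0) = (co j (a.1 (bas i))) • eOp K 0 0 := by
      have e0 : ∀ v, eOp K 0 j v = co j v • bas 0 := by
        intro v
        apply co_ext; intro l
        have hpow : ∀ j l (v : K[X]), co l ((derOp K ^ j) v) = co (l + j) v := by
          intro j
          induction j with
          | zero => simp
          | succ j ih => intro l v; rw [pow_succ, Module.End.mul_apply, ih, co_der]; congr 2
        cases l with
        | zero => simp [eOp, hpow, co_int_zero, co_bas]
        | succ l =>
          simp [eOp, hpow, co_int_succ, co_bas]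
          rw [sub_eq_zero]; congr 2; ring
      apply bas.ext; intro l
      cases l with
      | zero =>
        simp only [Module.End.mul_apply, LinearMap.smul_apply]
        have : eOp K i 0 (bas 0) = bas i := by simp [eOp, der_bas_zero, int_pow_bas]
        rw [this, e0]
        simp [eOp, der_bas_zero]
      | succ l =>
        simp only [Module.End.mul_apply, LinearMap.smul_apply]
        have : ∀ i, eOp K i 0 (bas (l+1)) = 0 := fun i => by
          simp [eOp, der_bas_succ, int_pow_bas]
          rw [sub_eq_zero]; congr 1; ring
        simp [this]
    have hE' : (⟨eOp K 0 j, eOp_mem K 0 j⟩ * a * ⟨eOp K i 0, eOp_mem K i 0⟩ : I1 K)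
        = (co j (a.1 (bas i))) • ⟨eOp K 0 0, eOp_mem K 0 0⟩ := Subtype.ext hE
    have h1 := congrArg τ hE'
    have ha' : τ a = 0 := by rw [hτi, ha]; rfl
    rw [map_mul, map_mul, ha', mul_zero, zero_mul, map_smul] at h1
    have h2 := (smul_eq_zero.1 h1.symm).resolve_left hij
    have h3 : (⟨eOp K 0 0, eOp_mem K 0 0⟩ : I1 K) + IntI K * DelI K = 1 := by
      apply Subtype.ext
      simp [eOp, IntI, DelI]
    have h5 := congrArg τ h3
    rw [map_add, h2, map_mul, map_one, zero_add] at h5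
    have h4 := LinearMap.congr_fun h5 y
    change w (u y) = y at h4
    rw [huy, map_zero] at h4
    exact hy0 h4.symm
  · have hle : I1 K ≤ R := by
      apply Algebra.adjoin_le
      rintro x (rfl | rfl | rfl)
      · exact hx
      · exact hder
      · exact hint
    rintro ⟨a, ha⟩
    obtain ⟨b, hb⟩ := hle ha
    exact ⟨b, Subtype.ext hb⟩

end
end

section
/- For every unit u of the algebra I_1, the unital K-subalgebra of I_1 generated by u is finite-dimensional as a K-vector space. -/
set_option linter.unusedSectionVars false

open Polynomial

noncomputable section

variable (K : Type*) [Field K] [CharZero K]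

/-- divided powers -/
def dE (i : ℤ) : Polynomial K := monomial i.toNat ((i.toNat.factorial : K)⁻¹)

def ph (m : ℤ) : Polynomial K →ₗ[K] K := (m.toNat.factorial : K) • Polynomial.lcoeff K m.toNat

lemma ph_dE (m i : ℤ) (hm : 0 ≤ m) (hi : 0 ≤ i) : ph K m (dE K i) = if i = m then 1 else 0 := by
  have hf : (m.toNat.factorial : K) ≠ 0 := by exact_mod_cast Nat.factorial_ne_zero _
  unfold ph dE
  by_cases h : i = m
  · subst h
    simp [hf]
  · have : i.toNat ≠ m.toNat := by omega
    simp [coeff_monomial, h, this]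

def Ev (a : Module.End K (Polynomial K)) : Prop :=
  ∃ p : ℤ →₀ Polynomial K, ∃ M : ℤ, ∀ n : ℤ, M ≤ n →
    a (dE K n) = p.sum fun k f => f.eval (n : K) • dE K (n + k)

lemma Ev_single (a : Module.End K (Polynomial K)) (k : ℤ) (f : Polynomial K) (M : ℤ)
    (h : ∀ n : ℤ, M ≤ n → a (dE K n) = f.eval (n : K) • dE K (n + k)) : Ev K a :=
  ⟨Finsupp.single k f, M, fun n hn => by rw [h n hn, Finsupp.sum_single_index]; simp⟩

lemma fac_succ (n : ℕ) : (((n+1).factorial : K))⁻¹ = ((n : K) + 1)⁻¹ * (n.factorial : K)⁻¹ := by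
  rw [Nat.factorial_succ]; push_cast; rw [mul_inv]

lemma Ev_x : Ev K (xOp K) := by
  refine Ev_single K _ 1 (X + 1) 0 fun n hn => ?_
  lift n to ℕ using hn
  have h1 : ((n : ℤ) + 1).toNat = n + 1 := by omega
  have h2 : ((n : K) + 1) ≠ 0 := by exact_mod_cast Nat.succ_ne_zero n
  simp only [dE, h1, xOp, Int.toNat_natCast, LinearMap.mulLeft_apply, X_mul_monomial, smul_monomial, fac_succ]
  congr 1
  simp
  field_simp

lemma Ev_int : Ev K (intOp K) := by
  refine Ev_single K _ 1 1 0 fun n hn => ?_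
  lift n to ℕ using hn
  have h1 : ((n : ℤ) + 1).toNat = n + 1 := by omega
  simp only [dE, h1, intOp, Int.toNat_natCast, fac_succ, Polynomial.lsum_apply]
  rw [sum_monomial_index] <;> simp [smul_monomial]

lemma Ev_der : Ev K (derOp K) := by
  refine Ev_single K _ (-1) 1 1 fun n hn => ?_
  obtain ⟨m, rfl⟩ : ∃ m : ℕ, n = m + 1 := ⟨(n - 1).toNat, by omega⟩
  have h1 : ((m : ℤ) + 1).toNat = m + 1 := by omega
  have h2 : ((m : K) + 1) ≠ 0 := by exact_mod_cast Nat.succ_ne_zero m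
  have h3 : ((m : ℤ) + 1 + -1).toNat = m := by omega
  simp only [dE, h1, h3, derOp, fac_succ, derivative_monomial]
  simp
  field_simp

lemma Ev_alg (c : K) : Ev K (algebraMap K _ c) := by
  refine Ev_single K _ 0 (C c) 0 fun n hn => ?_
  simp [Module.algebraMap_end_apply]

lemma Ev_add {a b : Module.End K (Polynomial K)} (ha : Ev K a) (hb : Ev K b) : Ev K (a + b) := by
  obtain ⟨p, M, hp⟩ := ha
  obtain ⟨q, N, hq⟩ := hb
  refine ⟨p + q, max M N, fun n hn => ?_⟩
  rw [Finsupp.sum_add_index', LinearMap.add_apply, hp n (le_trans (le_max_left _ _) hn),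
    hq n (le_trans (le_max_right _ _) hn)]
  · simp
  · intros; simp [add_smul]

lemma supp_bd (q : ℤ →₀ Polynomial K) : ∃ B : ℤ, 0 ≤ B ∧ ∀ k ∈ q.support, -B ≤ k := by
  obtain ⟨b, hb⟩ := q.support.bddBelow
  refine ⟨max 0 (-b), le_max_left _ _, fun k hk => ?_⟩
  have := hb hk
  have := le_max_right 0 (-b)
  omega

lemma mul_form {a b : Module.End K (Polynomial K)} {p q : ℤ →₀ Polynomial K} {M N : ℤ}
    (hp : ∀ n : ℤ, M ≤ n → a (dE K n) = p.sum fun k f => f.eval (n : K) • dE K (n + k))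
    (hq : ∀ n : ℤ, N ≤ n → b (dE K n) = q.sum fun k f => f.eval (n : K) • dE K (n + k)) :
    ∃ L : ℤ, ∀ n : ℤ, L ≤ n → (a * b) (dE K n) =
      ∑ k ∈ q.support, ∑ j ∈ p.support,
        ((q k).eval (n : K) * (p j).eval ((n : K) + k)) • dE K (n + k + j) := by
  obtain ⟨B, hB0, hB⟩ := supp_bd K q
  refine ⟨max N (M + B), fun n hn => ?_⟩
  have h1 := le_max_left N (M + B)
  have h2 := le_max_right N (M + B)
  rw [Module.End.mul_apply, hq n (by omega), Finsupp.sum, map_sum]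
  refine Finset.sum_congr rfl fun k hk => ?_
  have := hB k hk
  rw [map_smul, hp (n + k) (by omega), Finsupp.sum, Finset.smul_sum]
  refine Finset.sum_congr rfl fun j hj => ?_
  rw [smul_smul]; push_cast; rfl

lemma Ev_mul {a b : Module.End K (Polynomial K)} (ha : Ev K a) (hb : Ev K b) : Ev K (a * b) := by
  obtain ⟨p, M, hp⟩ := ha
  obtain ⟨q, N, hq⟩ := hb
  obtain ⟨L, hL⟩ := mul_form K hp hq
  refine ⟨∑ k ∈ q.support, ∑ j ∈ p.support,
    Finsupp.single (k + j) (q k * (p j).comp (X + C (k : K))), L, fun n hn => ?_⟩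
  rw [hL n hn, ← Finsupp.sum_finsetSum_index (by simp) (by intros; simp [add_smul])]
  refine Finset.sum_congr rfl fun k hk => ?_
  rw [← Finsupp.sum_finsetSum_index (by simp) (by intros; simp [add_smul])]
  refine Finset.sum_congr rfl fun j hj => ?_
  rw [Finsupp.sum_single_index (by simp)]
  simp [add_assoc]

lemma Ev_I1 {a : Module.End K (Polynomial K)} (ha : a ∈ I1 K) : Ev K a := by
  unfold I1 at ha
  induction ha using Algebra.adjoin_induction with
  | mem x hx =>
    simp only [Set.mem_insert_iff, Set.mem_singleton_iff] at hx
    rcases hx with rfl | rfl | rfl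
    exacts [Ev_x K, Ev_der K, Ev_int K]
  | algebraMap r => exact Ev_alg K r
  | add x y _ _ hx hy => exact Ev_add K hx hy
  | mul x y _ _ hx hy => exact Ev_mul K hx hy

/-- a nonzero polynomial is eventually nonzero at integers -/
lemma ev_ne (f : Polynomial K) (hf : f ≠ 0) : ∃ L : ℤ, ∀ n : ℤ, L ≤ n → f.eval (n : K) ≠ 0 := by
  have hfin : {n : ℤ | f.eval (n : K) = 0}.Finite := by
    have : {n : ℤ | f.eval (n : K) = 0} = (fun n : ℤ => (n : K)) ⁻¹' {x | f.IsRoot x} := rfl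
    rw [this]
    exact (Polynomial.finite_setOfPred_isRoot hf).preimage (Int.cast_injective.injOn)
  obtain ⟨b, hb⟩ := hfin.bddAbove
  refine ⟨b + 1, fun n hn h => ?_⟩
  have := hb (show n ∈ {n : ℤ | f.eval (n : K) = 0} from h)
  omega

lemma key {a b : Module.End K (Polynomial K)} {p q : ℤ →₀ Polynomial K} {M N : ℤ}
    (hp : ∀ n : ℤ, M ≤ n → a (dE K n) = p.sum fun k f => f.eval (n : K) • dE K (n + k))
    (hq : ∀ n : ℤ, N ≤ n → b (dE K n) = q.sum fun k f => f.eval (n : K) • dE K (n + k))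
    (hab : a * b = 1) (i l : ℤ) (hi : i ∈ p.support) (hl : l ∈ q.support)
    (huniq : ∀ j ∈ p.support, ∀ k ∈ q.support, j + k = i + l → j = i ∧ k = l) :
    i + l = 0 ∧ q l * (p i).comp (X + C (l : K)) = 1 := by
  obtain ⟨L, hL⟩ := mul_form K hp hq
  obtain ⟨B, hB0, hB⟩ := supp_bd K q
  obtain ⟨A, hA0, hA⟩ := supp_bd K p
  set g := q l * (p i).comp (X + C (l : K)) with hg
  have hg0 : g ≠ 0 := by
    refine mul_ne_zero (Finsupp.mem_support_iff.1 hl) ?_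
    intro h
    have h2 : ((p i).comp (X + C (l : K))).comp (X - C (l : K)) = p i := by
      rw [comp_assoc]; simp
    rw [h] at h2
    exact Finsupp.mem_support_iff.1 hi (by rw [← h2]; simp)
  have main : ∀ n : ℤ, max L (A + B) ≤ n → (if i + l = 0 then (1 : K) else 0) = g.eval (n : K) := by
    intro n hn
    have h1 := le_max_left L (A + B)
    have h2 := le_max_right L (A + B)
    have h3 := hA i hi
    have h4 := hB l hl
    have h := congrArg (ph K (n + l + i)) (hL n (by omega))
    rw [hab, Module.End.one_apply, ph_dE K _ _ (by omega) (by omega), map_sum,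
      Finset.sum_eq_single_of_mem l hl, map_sum, Finset.sum_eq_single_of_mem i hi, map_smul,
      ph_dE K _ _ (by omega) (by omega), if_pos rfl] at h
    · have h5 : (n = n + l + i) ↔ (i + l = 0) := by omega
      simp only [h5] at h
      rw [h, hg]; simp
    · intro j hj hji
      have := hA j hj
      rw [map_smul, ph_dE K _ _ (by omega) (by omega), if_neg (by omega), smul_zero]
    · intro k hk hkl
      rw [map_sum]
      refine Finset.sum_eq_zero fun j hj => ?_
      have := hA j hj
      have := hB k hk
      rw [map_smul, ph_dE K _ _ (by omega) (by omega), if_neg, smul_zero]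
      intro h
      exact hkl (huniq j hj k hk (by omega)).2
  have h0 : i + l = 0 := by
    by_contra h0
    obtain ⟨T, hT⟩ := ev_ne K g hg0
    have := main (max (max L (A + B)) T) (le_max_left _ _)
    rw [if_neg h0] at this
    exact hT _ (le_max_right _ _) this.symm
  refine ⟨h0, ?_⟩
  by_contra hne
  obtain ⟨T, hT⟩ := ev_ne K (g - 1) (sub_ne_zero.2 hne)
  have h := main (max (max L (A + B)) T) (le_max_left _ _)
  rw [if_pos h0] at h
  apply hT _ (le_max_right (max L (A + B)) T)
  rw [eval_sub, ← h]; simp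

lemma supp_ne {a b : Module.End K (Polynomial K)} {p q : ℤ →₀ Polynomial K} {M N : ℤ}
    (hp : ∀ n : ℤ, M ≤ n → a (dE K n) = p.sum fun k f => f.eval (n : K) • dE K (n + k))
    (hq : ∀ n : ℤ, N ≤ n → b (dE K n) = q.sum fun k f => f.eval (n : K) • dE K (n + k))
    (hab : a * b = 1) : p.support.Nonempty ∧ q.support.Nonempty := by
  obtain ⟨L, hL⟩ := mul_form K hp hq
  have h := congrArg (ph K (max 0 L)) (hL (max 0 L) (le_max_right _ _))
  rw [hab, Module.End.one_apply, ph_dE K _ _ (le_max_left _ _) (le_max_left _ _), if_pos rfl] at h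
  constructor
  · by_contra hc
    rw [Finset.not_nonempty_iff_eq_empty] at hc
    simp [hc] at h
  · by_contra hc
    rw [Finset.not_nonempty_iff_eq_empty] at hc
    simp [hc] at h

lemma form {a b : Module.End K (Polynomial K)} (ha : Ev K a) (hb : Ev K b) (hab : a * b = 1) :
    ∃ (k : ℤ) (c d : K) (M : ℤ), (∀ n : ℤ, M ≤ n → a (dE K n) = c • dE K (n + k)) ∧
      (∀ n : ℤ, M ≤ n → b (dE K n) = d • dE K (n + -k)) := by
  obtain ⟨p, M, hp⟩ := ha
  obtain ⟨q, N, hq⟩ := hb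
  obtain ⟨np, nq⟩ := supp_ne K hp hq hab
  have h1 := key K hp hq hab _ _ (p.support.max'_mem np) (q.support.max'_mem nq) (by
    intro j hj k hk h
    have := p.support.le_max' j hj
    have := q.support.le_max' k hk
    omega)
  have h2 := key K hp hq hab _ _ (p.support.min'_mem np) (q.support.min'_mem nq) (by
    intro j hj k hk h
    have := p.support.min'_le j hj
    have := q.support.min'_le k hk
    omega)
  have h3 := p.support.min'_le _ (p.support.max'_mem np)
  have h4 := q.support.min'_le _ (q.support.max'_mem nq)
  obtain ⟨h10, h11⟩ := h1
  obtain ⟨h20, -⟩ := h2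
  set i := p.support.max' np with hi
  set l := q.support.max' nq with hl
  have sp : p.support ⊆ {i} := by
    intro j hj
    have := p.support.le_max' j hj
    have := p.support.min'_le j hj
    simp only [Finset.mem_singleton]
    omega
  have sq : q.support ⊆ {l} := by
    intro j hj
    have := q.support.le_max' j hj
    have := q.support.min'_le j hj
    simp only [Finset.mem_singleton]
    omega
  have uq : IsUnit (q l) := .of_mul_eq_one _ h11
  have up : IsUnit ((p i).comp (X + C (l : K))) := .of_mul_eq_one_right _ h11
  obtain ⟨d, -, hd⟩ := Polynomial.isUnit_iff.1 uq
  obtain ⟨c, -, hc⟩ := Polynomial.isUnit_iff.1 up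
  have hpc : p i = C c := by
    have h2 : ((p i).comp (X + C (l : K))).comp (X - C (l : K)) = p i := by
      rw [comp_assoc]; simp
    rw [← h2, ← hc]; simp
  refine ⟨i, c, d, max M N, fun n hn => ?_, fun n hn => ?_⟩
  · rw [hp n (le_trans (le_max_left _ _) hn), Finsupp.sum_of_support_subset _ sp _ (by simp)]
    simp [hpc]
  · rw [hq n (le_trans (le_max_right _ _) hn), Finsupp.sum_of_support_subset _ sq _ (by simp)]
    have : l = -i := by omega
    simp [← hd, ← this]

lemma mono_dE (n : ℕ) (c : K) : monomial n c = (c * (n.factorial : K)) • dE K n := by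
  have hf : (n.factorial : K) ≠ 0 := by exact_mod_cast Nat.factorial_ne_zero _
  simp [dE, smul_monomial, hf]

lemma index {a : Module.End K (Polynomial K)} (hs : Function.Surjective a) (k : ℤ) (hk : 0 ≤ k)
    (c : K) (M : ℤ) (h : ∀ n : ℤ, M ≤ n → a (dE K n) = c • dE K (n + k)) : k = 0 := by
  lift k to ℕ using hk
  set m := M.toNat with hm
  let g : degreeLT K m →ₗ[K] (Fin (m + k) → K) :=
    LinearMap.pi (fun i => (lcoeff K (i : ℕ)) ∘ₗ a ∘ₗ (degreeLT K m).subtype)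
  have tail : ∀ f : Polynomial K, ∀ i < m + k, (a (X ^ m * f)).coeff i = 0 := by
    intro f i hi
    induction f using Polynomial.induction_on' with
    | add p q hp hq => rw [mul_add, map_add, coeff_add, hp, hq, add_zero]
    | monomial n t =>
      rw [X_pow_mul_monomial, mono_dE, map_smul, h _ (by push_cast; omega), smul_smul, coeff_smul, dE,
        coeff_monomial, if_neg, smul_zero]
      push_cast; omega
  have gs : Function.Surjective g := by
    intro w
    obtain ⟨f, hf⟩ := hs (∑ i : Fin (m + k), monomial (i : ℕ) (w i))
    have hmon : (X ^ m : Polynomial K).Monic := monic_X_pow m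
    refine ⟨⟨f %ₘ X ^ m, ?_⟩, ?_⟩
    · rw [mem_degreeLT]
      simpa using degree_modByMonic_lt f hmon
    · funext i
      have e := modByMonic_add_div f (X ^ m : Polynomial K)
      have e2 := congrArg (fun z => (a z).coeff (i : ℕ)) e
      simp only [map_add, coeff_add, tail _ _ i.2, add_zero, hf] at e2
      change (a (f %ₘ X ^ m)).coeff (i : ℕ) = w i
      rw [e2]
      simp [finsetSum_coeff, coeff_monomial, Fin.val_inj]
  haveI : Module.Finite K (degreeLT K m) := Module.Finite.equiv (degreeLTEquiv K m).symm
  have := LinearMap.finrank_le_finrank_of_surjective gs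
  rw [(degreeLTEquiv K m).finrank_eq] at this
  simp at this
  exact_mod_cast this

lemma integral_of_finite {V : Type*} [AddCommGroup V] [Module K V] (f : Module.End K V)
    (hf : Module.Finite K (LinearMap.range f)) : IsIntegral K f := by
  let r : Module.End K (LinearMap.range f) := f.restrict (fun x _ => ⟨x, rfl⟩)
  obtain ⟨χ, hm, h0⟩ := Algebra.IsIntegral.isIntegral (R := K) r
  have hc : ∀ P : Polynomial K, ∀ x : LinearMap.range f, ((aeval r P x : LinearMap.range f) : V) = aeval f P (x : V) := by
    intro P x
    induction P using Polynomial.induction_on' with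
    | add p q hp hq => simp [hp, hq]
    | monomial n t =>
      simp only [aeval_monomial, Module.End.mul_apply, Module.algebraMap_end_apply, Submodule.coe_smul]
      congr 1
      induction n with
      | zero => simp
      | succ n ih => rw [pow_succ', pow_succ', Module.End.mul_apply, Module.End.mul_apply, ← ih]; rfl
  refine ⟨χ * X, hm.mul monic_X, ?_⟩
  rw [← aeval_def] at h0 ⊢
  ext x
  have := hc χ ⟨f x, ⟨x, rfl⟩⟩
  rw [h0] at this
  simpa using this.symm

set_option synthInstance.maxHeartbeats 1000000
set_option maxHeartbeats 1000000

lemma unit_integral (u : (I1 K)ˣ) : IsIntegral K (u : I1 K) := by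
  have huv : ((u : I1 K) : Module.End K (Polynomial K)) * ((u⁻¹ : (I1 K)ˣ) : I1 K) = 1 := by
    rw [← MulMemClass.coe_mul, Units.mul_inv]; rfl
  have hvu : (((u⁻¹ : (I1 K)ˣ) : I1 K) : Module.End K (Polynomial K)) * (u : I1 K) = 1 := by
    rw [← MulMemClass.coe_mul, Units.inv_mul]; rfl
  have ha := Ev_I1 K (u : I1 K).2
  have hb := Ev_I1 K ((u⁻¹ : (I1 K)ˣ) : I1 K).2
  suffices h : IsIntegral K ((u : I1 K) : Module.End K (Polynomial K)) from
    (isIntegral_algHom_iff (I1 K).val Subtype.val_injective).1 h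
  generalize ((u : I1 K) : Module.End K (Polynomial K)) = a at *
  generalize (((u⁻¹ : (I1 K)ˣ) : I1 K) : Module.End K (Polynomial K)) = b at *
  obtain ⟨k, c, d, M, h1, h2⟩ := form K ha hb huv
  have sa : Function.Surjective a := fun x => ⟨b x, by rw [← Module.End.mul_apply, huv]; rfl⟩
  have sb : Function.Surjective b := fun x => ⟨a x, by rw [← Module.End.mul_apply, hvu]; rfl⟩
  have hk : k = 0 := by
    rcases le_total 0 k with h | h
    · exact index K sa k h c M h1
    · have := index K sb (-k) (by omega) d M h2
      omega
  subst hk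
  set f := a - algebraMap K _ c with hf
  suffices hi : IsIntegral K f by
    obtain ⟨χ, hm, h0⟩ := hi
    refine ⟨χ.comp (X - C c), hm.comp_X_sub_C c, ?_⟩
    rw [← aeval_def] at h0 ⊢
    rw [aeval_comp, map_sub, aeval_X, aeval_C]
    exact h0
  apply integral_of_finite
  set m := M.toNat
  haveI : Module.Finite K (degreeLT K m) := Module.Finite.equiv (degreeLTEquiv K m).symm
  have tail : ∀ g : Polynomial K, f (X ^ m * g) = 0 := by
    intro g
    induction g using Polynomial.induction_on' with
    | add p q hp hq => rw [mul_add, map_add, hp, hq, add_zero]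
    | monomial n t =>
      rw [X_pow_mul_monomial, mono_dE, map_smul, hf, LinearMap.sub_apply, h1 _ (by push_cast; omega)]
      simp [Module.algebraMap_end_apply]
  have hr : LinearMap.range f ≤ (degreeLT K m).map f := by
    rintro _ ⟨x, rfl⟩
    refine ⟨x %ₘ X ^ m, ?_, ?_⟩
    · rw [SetLike.mem_coe, mem_degreeLT]
      simpa using degree_modByMonic_lt x (monic_X_pow m)
    · conv_rhs => rw [← modByMonic_add_div x (X ^ m : Polynomial K), map_add, tail, add_zero]
  exact Submodule.finiteDimensional_of_le hr

/-- For every unit `u` of the algebra `I₁`, the unital `K`-subalgebra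
of `I₁` generated by `u` is finite-dimensional as a `K`-vector space. -/
theorem adjoin_unit_finiteDimensional (u : (I1 K)ˣ) :
    letI : Ring (Algebra.adjoin K ({(u : I1 K)} : Set (I1 K))) :=
      @Subalgebra.toRing K ↥(I1 K) _ _ _ _
    FiniteDimensional K (Algebra.adjoin K ({(u : I1 K)} : Set (I1 K))) := by
  have h := (unit_integral K u).fg_adjoin_singleton
  exact Module.Finite.iff_fg.2 h

end
end
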